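/- Let c : ℝ → ℝ be convex, monotone increasing, and twice differentiable with c″/c′ monotone non-increasing. Fix θ ∈ ℝ^d, y ∈ {−1, +1}, and a convex set F_y ⊆ ℝ^d. Then the set G̃_{θ,y} = {α c′(−y ⟨θ, x⟩) (−y x) : 0 ≤ α ≤ 1, x ∈ F_y} is convex. Concretely, for any x₁, x₂ ∈ F_y and γ ∈ [0, 1], setting x̃ = (γ c′(−y⟨θ,x₁⟩) x₁ + (1−γ) c′(−y⟨θ,x₂⟩) x₂) / (γ c′(−y⟨θ,x₁⟩) + (1−γ) c′(−y⟨θ,x₂⟩)) and α = (γ c′(−y⟨θ,x₁⟩) + (1−γ) c′(−y⟨θ,x₂⟩)) / c′(−y⟨θ,x̃⟩), one has x̃ ∈ F_y, 0 < α ≤ 1, and α c′(−y⟨θ,x̃⟩)(−y x̃) = γ c′(−y⟨θ,x₁⟩)(−y x₁) + (1−γ) c′(−y⟨θ,x₂⟩)(−y x₂). -/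

import Mathlib

open scoped RealInnerProductSpace

/-- `Tmargin c' θ x₁ x₂ y γ = γ c'(−y⟨θ,x₁⟩) + (1−γ) c'(−y⟨θ,x₂⟩)`. -/
noncomputable def Tmargin {d : ℕ} (c' : ℝ → ℝ) (θ x₁ x₂ : EuclideanSpace ℝ (Fin d))
    (y γ : ℝ) : ℝ :=
  γ * c' (-(y * ⟪θ, x₁⟫)) + (1 - γ) * c' (-(y * ⟪θ, x₂⟫))

/-- `xtMargin` is the point `x̃ = (γ c'(−y⟨θ,x₁⟩) x₁ + (1−γ) c'(−y⟨θ,x₂⟩) x₂) / T`. -/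
noncomputable def xtMargin {d : ℕ} (c' : ℝ → ℝ) (θ x₁ x₂ : EuclideanSpace ℝ (Fin d))
    (y γ : ℝ) : EuclideanSpace ℝ (Fin d) :=
  (γ * c' (-(y * ⟪θ, x₁⟫)) / Tmargin c' θ x₁ x₂ y γ) • x₁ +
    ((1 - γ) * c' (-(y * ⟪θ, x₂⟫)) / Tmargin c' θ x₁ x₂ y γ) • x₂

/-- `alphaMargin` is the scaling `α = T / c'(−y⟨θ,x̃⟩)`. -/
noncomputable def alphaMargin {d : ℕ} (c' : ℝ → ℝ) (θ x₁ x₂ : EuclideanSpace ℝ (Fin d))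
    (y γ : ℝ) : ℝ :=
  Tmargin c' θ x₁ x₂ y γ / c' (-(y * ⟪θ, xtMargin c' θ x₁ x₂ y γ⟫))

theorem margin_deriv_pos (c c' : ℝ → ℝ) (hconv : ConvexOn ℝ Set.univ c)
    (hmono : StrictMono c) (hd1 : ∀ v, HasDerivAt c (c' v) v) (v : ℝ) : 0 < c' v := by
  have h := hconv.slope_le_of_hasDerivAt (x := v - 1) (y := v) (Set.mem_univ _) (Set.mem_univ _)
    (by linarith) (hd1 v)
  have h2 : c (v - 1) < c v := hmono (by linarith)
  rw [slope_def_field] at h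
  have h3 : v - (v - 1) = 1 := by ring
  rw [h3] at h
  linarith

theorem margin_key (f f' : ℝ → ℝ) (hpos : ∀ v, 0 < f v) (hd : ∀ v, HasDerivAt f (f' v) v)
    (hratio : Antitone fun v => f' v / f v) (u₁ u₂ γ T : ℝ) (h0 : 0 ≤ γ) (h1 : γ ≤ 1)
    (hT : T = γ * f u₁ + (1 - γ) * f u₂) (hTpos : 0 < T) :
    T ≤ f (γ * f u₁ / T * u₁ + (1 - γ) * f u₂ / T * u₂) := by
  have hl : ∀ v, HasDerivAt (fun v => Real.log (f v)) (f' v / f v) v :=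
    fun v => (hd v).log (hpos v).ne'
  have hder : deriv (fun v => Real.log (f v)) = fun v => f' v / f v :=
    funext fun v => (hl v).deriv
  have hconc : ConcaveOn ℝ Set.univ (fun v => Real.log (f v)) :=
    Antitone.concaveOn_univ_of_deriv (fun v => (hl v).differentiableAt) (by rw [hder]; exact hratio)
  have hp1 := hpos u₁
  have hp2 := hpos u₂
  have hg : 0 ≤ 1 - γ := by linarith
  have hA := hconc.2 (Set.mem_univ u₁) (Set.mem_univ u₂)
    (show 0 ≤ γ * f u₁ / T by positivity) (show 0 ≤ (1 - γ) * f u₂ / T by positivity)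
    (by rw [← add_div, ← hT, div_self hTpos.ne'])
  have hB := Real.convexOn_mul_log.2 (Set.mem_Ici.2 hp1.le) (Set.mem_Ici.2 hp2.le) h0 hg (by ring)
  simp only [smul_eq_mul] at hA hB
  rw [← hT] at hB
  rw [← Real.log_le_log_iff hTpos (hpos _)]
  refine le_trans ?_ hA
  have : γ * f u₁ / T * Real.log (f u₁) + (1 - γ) * f u₂ / T * Real.log (f u₂)
      = (γ * (f u₁ * Real.log (f u₁)) + (1 - γ) * (f u₂ * Real.log (f u₂))) / T := by
    field_simp
  rw [this, le_div_iff₀ hTpos]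
  linarith

/-- For a margin-based loss `ℓ(θ; x, y) = c(−y⟨θ,x⟩)` with `c` convex, monotone
increasing, twice differentiable, and `c''/c'` monotone non-increasing, and a convex
feasible slice `F_y` for the class `y ∈ {−1,+1}`, the set of scaled gradients
`G̃_{θ,y} = {α c'(−y⟨θ,x⟩)(−y x) : 0 ≤ α ≤ 1, x ∈ F_y}` is convex. Concretely, for
`x₁, x₂ ∈ F_y` and `γ ∈ [0,1]`, the point `x̃` and the scaling `α` defined above
satisfy `x̃ ∈ F_y`, `0 < α ≤ 1`, and
`α c'(−y⟨θ,x̃⟩)(−y x̃) = γ c'(−y⟨θ,x₁⟩)(−y x₁) + (1−γ) c'(−y⟨θ,x₂⟩)(−y x₂)`. -/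
theorem margin_scaled_gradients_class_convex
    {d : ℕ} (c c' c'' : ℝ → ℝ)
    (hconv : ConvexOn ℝ Set.univ c)
    (hmono : StrictMono c)
    (hd1 : ∀ v, HasDerivAt c (c' v) v)
    (hd2 : ∀ v, HasDerivAt c' (c'' v) v)
    (hratio : Antitone fun v => c'' v / c' v)
    (θ : EuclideanSpace ℝ (Fin d)) (y : ℝ) (hy : y = 1 ∨ y = -1)
    (Fy : Set (EuclideanSpace ℝ (Fin d))) (hFy : Convex ℝ Fy) :
    Convex ℝ {g : EuclideanSpace ℝ (Fin d) |
        ∃ (α : ℝ) (x : EuclideanSpace ℝ (Fin d)), 0 ≤ α ∧ α ≤ 1 ∧ x ∈ Fy ∧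
          g = (α * c' (-(y * ⟪θ, x⟫))) • ((-y) • x)} ∧
    ∀ x₁ ∈ Fy, ∀ x₂ ∈ Fy, ∀ γ : ℝ, 0 ≤ γ → γ ≤ 1 →
      xtMargin c' θ x₁ x₂ y γ ∈ Fy ∧
      0 < alphaMargin c' θ x₁ x₂ y γ ∧ alphaMargin c' θ x₁ x₂ y γ ≤ 1 ∧
      (alphaMargin c' θ x₁ x₂ y γ * c' (-(y * ⟪θ, xtMargin c' θ x₁ x₂ y γ⟫))) •
          ((-y) • xtMargin c' θ x₁ x₂ y γ)
        = (γ * c' (-(y * ⟪θ, x₁⟫))) • ((-y) • x₁) +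
            ((1 - γ) * c' (-(y * ⟪θ, x₂⟫))) • ((-y) • x₂) := by
  have hpos := margin_deriv_pos c c' hconv hmono hd1
  have main : ∀ x₁ ∈ Fy, ∀ x₂ ∈ Fy, ∀ γ : ℝ, 0 ≤ γ → γ ≤ 1 →
      xtMargin c' θ x₁ x₂ y γ ∈ Fy ∧
      0 < alphaMargin c' θ x₁ x₂ y γ ∧ alphaMargin c' θ x₁ x₂ y γ ≤ 1 ∧
      (alphaMargin c' θ x₁ x₂ y γ * c' (-(y * ⟪θ, xtMargin c' θ x₁ x₂ y γ⟫))) •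
          ((-y) • xtMargin c' θ x₁ x₂ y γ)
        = (γ * c' (-(y * ⟪θ, x₁⟫))) • ((-y) • x₁) +
            ((1 - γ) * c' (-(y * ⟪θ, x₂⟫))) • ((-y) • x₂) := by
    intro x₁ hx₁ x₂ hx₂ γ h0 h1
    have hp1 := hpos (-(y * ⟪θ, x₁⟫))
    have hp2 := hpos (-(y * ⟪θ, x₂⟫))
    have hg : 0 ≤ 1 - γ := by linarith
    have hT : Tmargin c' θ x₁ x₂ y γ
      = γ * c' (-(y * ⟪θ, x₁⟫)) + (1 - γ) * c' (-(y * ⟪θ, x₂⟫)) := rfl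
    have hTpos : 0 < Tmargin c' θ x₁ x₂ y γ := by
      rw [hT]
      rcases h0.eq_or_lt with h | h
      · rw [← h]; simpa using hp2
      · have := mul_pos h hp1
        have := mul_nonneg hg hp2.le
        linarith
    have hpt := hpos (-(y * ⟪θ, xtMargin c' θ x₁ x₂ y γ⟫))
    have hk := margin_key c' c'' hpos hd2 hratio _ _ γ _ h0 h1 hT hTpos
    have hxt : -(y * ⟪θ, xtMargin c' θ x₁ x₂ y γ⟫)
        = γ * c' (-(y * ⟪θ, x₁⟫)) / Tmargin c' θ x₁ x₂ y γ * (-(y * ⟪θ, x₁⟫))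
          + (1 - γ) * c' (-(y * ⟪θ, x₂⟫)) / Tmargin c' θ x₁ x₂ y γ * (-(y * ⟪θ, x₂⟫)) := by
      rw [xtMargin, inner_add_right, inner_smul_right, inner_smul_right]
      ring
    rw [← hxt] at hk
    refine ⟨?_, div_pos hTpos hpt, (div_le_one hpt).2 hk, ?_⟩
    · refine hFy hx₁ hx₂ (by positivity) (by positivity) ?_
      rw [← add_div, ← hT, div_self hTpos.ne']
    · rw [alphaMargin, div_mul_cancel₀ _ hpt.ne', xtMargin, smul_comm _ (-y), smul_add, smul_smul,
        smul_smul, mul_div_cancel₀ _ hTpos.ne', mul_div_cancel₀ _ hTpos.ne', smul_add,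
        smul_comm _ (-y) x₁, smul_comm _ (-y) x₂]
  refine ⟨?_, main⟩
  rintro _ ⟨α₁, x₁, h01, h11, hx₁, rfl⟩ _ ⟨α₂, x₂, h02, h12, hx₂, rfl⟩ a b ha hb hab
  have n1 : 0 ≤ a * α₁ := mul_nonneg ha h01
  have n2 : 0 ≤ b * α₂ := mul_nonneg hb h02
  have hs1 : a * α₁ + b * α₂ ≤ 1 := by nlinarith
  rcases (add_nonneg n1 n2).eq_or_lt with hs | hs
  · refine ⟨0, x₁, le_rfl, zero_le_one, hx₁, ?_⟩
    have e1 : a * α₁ = 0 := by linarith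
    have e2 : b * α₂ = 0 := by linarith
    rw [smul_smul a, smul_smul b, ← mul_assoc, ← mul_assoc, e1, e2]
    simp
  · obtain ⟨hm, hp, hle, he⟩ := main x₁ hx₁ x₂ hx₂ (a * α₁ / (a * α₁ + b * α₂)) (by positivity)
      ((div_le_one hs).2 (by linarith))
    refine ⟨(a * α₁ + b * α₂) * alphaMargin c' θ x₁ x₂ y (a * α₁ / (a * α₁ + b * α₂)), _,
      by positivity, mul_le_one₀ hs1 hp.le hle, hm, ?_⟩
    rw [mul_assoc, ← smul_smul (a * α₁ + b * α₂), he, smul_add, smul_smul a, smul_smul b,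
      smul_smul (a * α₁ + b * α₂), smul_smul (a * α₁ + b * α₂)]
    congr 2
    · field_simp
    · field_simp
      ring
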